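/- Let π₁,…,π_b ∈ ℝ[x₁,…,x_n] be nonconstant polynomials of degree one inducing a hyperplane partition of ℝⁿ, let f be a spline of degree d ≥ 1 on this partition, let Π and Π' be two distinct chambers with Euclidean closures V, W satisfying V ∩ W ≠ ∅, and let g, h ∈ ℝ[x₁,…,x_n] be the polynomials with f = g on Π and f = h on Π'. Then there exist q ≤ n + 1, degree-one polynomials π'₁,…,π'_q with π'_k ≥ 0 on V and π'_k ≤ 0 on W for each k, and polynomials ρ₁,…,ρ_q with deg ρ_k ≤ d − 1, such that g − h = π'₁ρ₁ + ⋯ + π'_qρ_q. -/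

import Mathlib

open MvPolynomial

/-- The piece of the partition of `ℝⁿ` induced by the polynomials `π`
corresponding to the sign vector `θ ∈ {-1,0,1}^b`. -/
def piece {n b : ℕ} (π : Fin b → MvPolynomial (Fin n) ℝ)
    (θ : Fin b → SignType) : Set (Fin n → ℝ) :=
  {x | ∀ i, SignType.sign (eval x (π i)) = θ i}

/-- `f : ℝⁿ → ℝ` is a spline of degree `d` on the partition induced by `π`. -/
def IsSpline {n b : ℕ} (π : Fin b → MvPolynomial (Fin n) ℝ) (d : ℕ)
    (f : (Fin n → ℝ) → ℝ) : Prop :=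
  Continuous f ∧ ∀ θ : Fin b → SignType, (piece π θ).Nonempty →
    ∃ g : MvPolynomial (Fin n) ℝ, g.totalDegree ≤ d ∧ ∀ x ∈ piece π θ, f x = eval x g

lemma poly_zero_of_open {n : ℕ} (p : MvPolynomial (Fin n) ℝ) (U : Set (Fin n → ℝ))
    (hU : IsOpen U) (hne : U.Nonempty) (h : ∀ x ∈ U, eval x p = 0) : p = 0 := by
  obtain ⟨x, hx⟩ := hne
  obtain ⟨ε, hε, hb⟩ := Metric.isOpen_iff.1 hU x hx
  refine funext_set (fun i => Metric.ball (x i) ε) (fun i => ?_) ?_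
  · rw [Real.ball_eq_Ioo]
    exact Set.Ioo_infinite (by linarith)
  · intro y hy
    rw [h y (hb ?_), map_zero]
    rw [Metric.mem_ball, dist_pi_lt_iff hε]
    intro i
    exact hy i (Set.mem_univ i)

lemma mem_affine_span {n : ℕ} (p : MvPolynomial (Fin n) ℝ) (hp : p.totalDegree ≤ 1) :
    p ∈ Submodule.span ℝ (Set.range (fun o : Option (Fin n) =>
      (o.elim 1 X : MvPolynomial (Fin n) ℝ))) := by
  rw [p.as_sum]
  refine Submodule.sum_mem _ fun m hm => ?_
  have h1 : m.degree ≤ 1 := (le_totalDegree hm).trans hp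
  have h2 : m = 0 ∨ ∃ i, m = Finsupp.single i 1 := by
    rcases Nat.le_one_iff_eq_zero_or_eq_one.1 h1 with h | h
    · left; exact (Finsupp.degree_eq_zero_iff m).1 h
    · right
      have hm0 : m ≠ 0 := by rintro rfl; simp at h
      obtain ⟨i, hi⟩ := Finsupp.ne_iff.1 hm0
      refine ⟨i, ?_⟩
      have hle : Finsupp.single i 1 ≤ m := by
        rw [Finsupp.single_le_iff]
        exact Nat.one_le_iff_ne_zero.2 hi
      obtain ⟨k, rfl⟩ := exists_add_of_le hle
      have hk : k.degree = 0 := by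
        rw [map_add, Finsupp.degree_single] at h
        omega
      rw [(Finsupp.degree_eq_zero_iff k).1 hk, add_zero]
  have h3 : monomial m (coeff m p) = (coeff m p) • (monomial m (1:ℝ)) := by
    rw [smul_monomial]; simp
  rw [h3]
  refine Submodule.smul_mem _ _ (Submodule.subset_span ?_)
  rcases h2 with rfl | ⟨i, rfl⟩
  · exact ⟨none, rfl⟩
  · exact ⟨some i, rfl⟩

lemma eval_affine {n : ℕ} (p : MvPolynomial (Fin n) ℝ) (hp : p.totalDegree ≤ 1)
    (w x y : Fin n → ℝ) (s : ℝ) :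
    eval (w + s • (x - y)) p = eval w p + s * (eval x p - eval y p) := by
  have hm := mem_affine_span p hp
  clear hp
  induction hm using Submodule.span_induction with
  | mem q hq =>
    obtain ⟨o, rfl⟩ := hq
    cases o <;> simp
  | zero => simp
  | add a b _ _ ha hb => 
    simp only [map_add, ha, hb]; ring
  | smul c a _ ha => 
    simp only [smul_eval, ha]; ring

lemma dvd_of_vanish {n : ℕ} (l p : MvPolynomial (Fin n) ℝ) (hl : l.totalDegree ≤ 1)
    (x y : Fin n → ℝ) (hxy : eval x l ≠ eval y l) (z : Fin n → ℝ) (hz : eval z l = 0)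
    (U : Set (Fin n → ℝ)) (hU : IsOpen U) (hzU : z ∈ U)
    (h : ∀ w ∈ U, eval w l = 0 → eval w p = 0) : l ∣ p := by
  have hne : eval x l - eval y l ≠ 0 := sub_ne_zero.2 hxy
  let v : Fin n → ℝ := (eval x l - eval y l)⁻¹ • (x - y)
  let σ : MvPolynomial (Fin n) ℝ →ₐ[ℝ] MvPolynomial (Fin n) ℝ :=
    aeval (fun i => X i - C (v i) * l)
  have hσ : ∀ q w, eval w (σ q) = eval (w + (- (eval w l)) • v) q := by
    intro q w
    induction q using MvPolynomial.induction_on with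
    | C a => simp [σ]
    | add a b ha hb => simp only [map_add, ha, hb]
    | mul_X a i ha =>
      simp only [map_mul, ha, eval_X]
      simp [σ]
      left; ring
  have h0 : σ p = 0 := by
    let φ : (Fin n → ℝ) → (Fin n → ℝ) := fun w => w + (- (eval w l)) • v
    have hφ : Continuous φ := by
      have := MvPolynomial.continuous_eval l
      fun_prop
    refine poly_zero_of_open _ (φ ⁻¹' U) (hU.preimage hφ) ⟨z, ?_⟩ ?_
    · simpa [φ, hz] using hzU
    · intro w hw
      rw [hσ]
      refine h _ hw ?_
      simp only [v, smul_smul]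
      rw [eval_affine l hl]
      field_simp
      ring
  have h1 : (Ideal.Quotient.mkₐ ℝ (Ideal.span {l})).comp σ
      = Ideal.Quotient.mkₐ ℝ (Ideal.span {l}) := by
    apply MvPolynomial.algHom_ext
    intro i
    simp only [AlgHom.comp_apply, σ, aeval_X, Ideal.Quotient.mkₐ_eq_mk]
    rw [Ideal.Quotient.eq, Ideal.mem_span_singleton]
    exact ⟨- C (v i), by ring⟩
  have h2 := congrArg (fun F => F p) h1
  simp only [AlgHom.comp_apply, h0, map_zero, Ideal.Quotient.mkₐ_eq_mk] at h2
  rw [← Ideal.mem_span_singleton]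
  exact Ideal.Quotient.eq_zero_iff_mem.1 h2.symm

lemma mem_mul_span {n q e : ℕ} (F : Fin q → MvPolynomial (Fin n) ℝ) (p : MvPolynomial (Fin n) ℝ)
    (hp : p ∈ Submodule.span ℝ (Set.range F) * restrictTotalDegree (Fin n) ℝ e) :
    ∃ ρ : Fin q → MvPolynomial (Fin n) ℝ, (∀ k, (ρ k).totalDegree ≤ e) ∧
      p = ∑ k, F k * ρ k := by
  simp only [← mem_restrictTotalDegree]
  induction hp using Submodule.mul_induction_on' with
  | mem_mul_mem a ha r hr =>
    obtain ⟨c, rfl⟩ := (Submodule.mem_span_range_iff_exists_fun ℝ).1 ha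
    refine ⟨fun k => c k • r, fun k => Submodule.smul_mem _ _ hr, ?_⟩
    rw [Finset.sum_mul]
    refine Finset.sum_congr rfl fun k _ => ?_
    rw [smul_mul_assoc, mul_smul_comm]
  | add a _ b _ ha hb =>
    obtain ⟨r, hr, rfl⟩ := ha
    obtain ⟨t, ht, rfl⟩ := hb
    refine ⟨fun k => r k + t k, fun k => Submodule.add_mem _ (hr k) (ht k), ?_⟩
    rw [← Finset.sum_add_distrib]
    exact Finset.sum_congr rfl fun k _ => by ring

lemma isOpen_piece {n b : ℕ} (π : Fin b → MvPolynomial (Fin n) ℝ) (θ : Fin b → SignType)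
    (hθ : ∀ i, θ i ≠ 0) : IsOpen (piece π θ) := by
  have : piece π θ = ⋂ i, {x | SignType.sign (eval x (π i)) = θ i} := by
    ext x; simp [piece]
  rw [this]
  refine isOpen_iInter_of_finite fun i => ?_
  have hc := MvPolynomial.continuous_eval (π i)
  have := hθ i
  cases h : θ i with
  | zero => exact absurd h this
  | neg =>
    have : {x | SignType.sign (eval x (π i)) = SignType.neg} = {x | eval x (π i) < 0} := by
      ext x; exact sign_eq_neg_one_iff
    rw [this]; exact isOpen_lt hc continuous_const
  | pos =>
    have : {x | SignType.sign (eval x (π i)) = SignType.pos} = {x | 0 < eval x (π i)} := by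
      ext x; exact sign_eq_one_iff
    rw [this]; exact isOpen_lt continuous_const hc

lemma sign_ne_zero_of_interior {n b : ℕ} (π : Fin b → MvPolynomial (Fin n) ℝ)
    (hπ : ∀ i, (π i).totalDegree = 1) (θ : Fin b → SignType)
    (hcham : (interior (piece π θ)).Nonempty) (i : Fin b) : θ i ≠ 0 := by
  intro h
  have : π i = 0 := poly_zero_of_open _ _ isOpen_interior hcham fun x hx => by
    have := interior_subset hx i
    rw [h] at this
    exact sign_eq_zero_iff.1 this
  have h2 := hπ i
  simp [this] at h2

lemma limit_eq {n : ℕ} (f : (Fin n → ℝ) → ℝ) (hf : Continuous f) (S : Set (Fin n → ℝ))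
    (g : MvPolynomial (Fin n) ℝ) (hg : ∀ x ∈ S, f x = eval x g) (w : Fin n → ℝ)
    (hw : w ∈ closure S) : f w = eval w g := by
  have hc : IsClosed {x | f x = eval x g} := isClosed_eq hf (MvPolynomial.continuous_eval g)
  exact closure_minimal (fun x hx => hg x hx) hc hw

/-- moving from `w` in direction `x - y` enters the given piece. -/
lemma mem_closure_piece {n b : ℕ} (π : Fin b → MvPolynomial (Fin n) ℝ)
    (hπ : ∀ i, (π i).totalDegree = 1) (θ : Fin b → SignType) (w x y : Fin n → ℝ)
    (h : ∀ i, (eval w (π i) ≠ 0 ∧ SignType.sign (eval w (π i)) = θ i) ∨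
      (eval w (π i) = 0 ∧ SignType.sign (eval x (π i) - eval y (π i)) = θ i)) :
    w ∈ closure (piece π θ) := by
  have hc : Filter.Tendsto (fun s : ℝ => w + s • (x - y)) (nhdsWithin 0 (Set.Ioi 0)) (nhds w) := by
    have : Continuous (fun s : ℝ => w + s • (x - y)) := by fun_prop
    have h2 := this.tendsto 0
    simp only [zero_smul, add_zero] at h2
    exact h2.mono_left nhdsWithin_le_nhds
  refine mem_closure_of_tendsto hc ?_
  change ∀ᶠ s : ℝ in nhdsWithin 0 (Set.Ioi 0), ∀ i, _
  rw [Filter.eventually_all]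
  intro i
  rcases h i with ⟨h0, h1⟩ | ⟨h0, h1⟩
  · have hc2 : Filter.Tendsto (fun s : ℝ => eval (w + s • (x - y)) (π i))
        (nhdsWithin 0 (Set.Ioi 0)) (nhds (eval w (π i))) :=
      ((MvPolynomial.continuous_eval (π i)).tendsto w).comp hc
    rw [← h1]
    rcases lt_or_gt_of_ne h0 with h3 | h3
    · filter_upwards [hc2.eventually_lt_const h3] with s hs
      rw [sign_neg hs, sign_neg h3]
    · filter_upwards [hc2.eventually_const_lt h3] with s hs
      rw [sign_pos hs, sign_pos h3]
  · filter_upwards [self_mem_nhdsWithin] with s hs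
    rw [eval_affine _ (hπ i).le, h0, zero_add, sign_mul, sign_pos hs, one_mul, h1]

lemma generic_point {n b : ℕ} (π : Fin b → MvPolynomial (Fin n) ℝ) (y : Fin n → ℝ)
    (U : Set (Fin n → ℝ)) (hU : IsOpen U) (hne : U.Nonempty) :
    ∃ x ∈ U, ∀ i j, eval x (π i) * eval y (π j) = eval x (π j) * eval y (π i) →
      C (eval y (π j)) * π i = C (eval y (π i)) * π j := by
  classical
  let P : Fin b → Fin b → MvPolynomial (Fin n) ℝ := fun i j =>
    C (eval y (π j)) * π i - C (eval y (π i)) * π j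
  let Q : MvPolynomial (Fin n) ℝ := ∏ i, ∏ j, if P i j = 0 then 1 else P i j
  have hQ : Q ≠ 0 := by
    refine Finset.prod_ne_zero_iff.2 fun i _ => Finset.prod_ne_zero_iff.2 fun j _ => ?_
    split_ifs with h
    · exact one_ne_zero
    · exact h
  by_contra hcon
  push Not at hcon
  refine hQ (poly_zero_of_open Q U hU hne fun x hx => ?_)
  obtain ⟨i, j, h1, h2⟩ := hcon x hx
  simp only [Q, map_prod]
  refine Finset.prod_eq_zero (Finset.mem_univ i) (Finset.prod_eq_zero (Finset.mem_univ j) ?_)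
  have h3 : P i j ≠ 0 := sub_ne_zero.2 h2
  rw [if_neg h3]
  simp only [P, map_sub, map_mul, eval_C]
  linarith

/-- crossing the first wall -/
lemma crossing {n b : ℕ} (π : Fin b → MvPolynomial (Fin n) ℝ)
    (hπ : ∀ i, (π i).totalDegree = 1) (θ θ' : Fin b → SignType)
    (hθ : ∀ i, θ i ≠ 0) (hθ' : ∀ i, θ' i ≠ 0)
    (x y : Fin n → ℝ) (hx : x ∈ piece π θ) (hy : y ∈ piece π θ') (hne : ∃ i, θ i ≠ θ' i) :
    ∃ (z : Fin n → ℝ) (i₀ : Fin b), eval z (π i₀) = 0 ∧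
      (∀ j, eval z (π j) ≠ 0 → SignType.sign (eval z (π j)) = θ j) ∧
      (∀ j, eval z (π j) = 0 → θ j ≠ θ' j ∧
        eval x (π i₀) * eval y (π j) = eval x (π j) * eval y (π i₀)) := by
  classical
  let I : Finset (Fin b) := Finset.univ.filter fun i => θ i ≠ θ' i
  let a : Fin b → ℝ := fun i => eval x (π i)
  let c : Fin b → ℝ := fun i => eval y (π i)
  have hopp : ∀ i, (0 < a i ∧ θ i = 1 ∨ a i < 0 ∧ θ i = -1) := by
    intro i
    have h1 : SignType.sign (a i) = θ i := hx i
    rcases lt_trichotomy (a i) 0 with h | h | h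
    · rw [sign_neg h] at h1; exact Or.inr ⟨h, h1.symm⟩
    · rw [h, sign_zero] at h1; exact absurd h1.symm (hθ i)
    · rw [sign_pos h] at h1; exact Or.inl ⟨h, h1.symm⟩
  have hopp' : ∀ i, (0 < c i ∧ θ' i = 1 ∨ c i < 0 ∧ θ' i = -1) := by
    intro i
    have h1 : SignType.sign (c i) = θ' i := hy i
    rcases lt_trichotomy (c i) 0 with h | h | h
    · rw [sign_neg h] at h1; exact Or.inr ⟨h, h1.symm⟩
    · rw [h, sign_zero] at h1; exact absurd h1.symm (hθ' i)
    · rw [sign_pos h] at h1; exact Or.inl ⟨h, h1.symm⟩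
  have hI : ∀ i, θ i ≠ θ' i → (0 < a i ∧ c i < 0 ∧ θ i = 1) ∨ (a i < 0 ∧ 0 < c i ∧ θ i = -1) := by
    intro i hi
    rcases hopp i with ⟨h1, h2⟩ | ⟨h1, h2⟩ <;> rcases hopp' i with ⟨h3, h4⟩ | ⟨h3, h4⟩
    · exact absurd (h2.trans h4.symm) hi
    · exact Or.inl ⟨h1, h3, h2⟩
    · exact Or.inr ⟨h1, h3, h2⟩
    · exact absurd (h2.trans h4.symm) hi
  have hnI : ∀ i, θ i = θ' i → (0 < a i ∧ 0 < c i ∧ θ i = 1) ∨ (a i < 0 ∧ c i < 0 ∧ θ i = -1) := by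
    intro i hi
    rcases hopp i with ⟨h1, h2⟩ | ⟨h1, h2⟩ <;> rcases hopp' i with ⟨h3, h4⟩ | ⟨h3, h4⟩
    · exact Or.inl ⟨h1, h3, h2⟩
    · rw [h2, h4] at hi; exact absurd hi (by decide)
    · rw [h2, h4] at hi; exact absurd hi (by decide)
    · exact Or.inr ⟨h1, h3, h2⟩
  let t : Fin b → ℝ := fun i => a i / (a i - c i)
  have hIne : I.Nonempty := by
    obtain ⟨i, hi⟩ := hne
    exact ⟨i, by simp [I, hi]⟩
  obtain ⟨i₀, hi₀, hmin⟩ := Finset.exists_min_image I t hIne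
  have hi₀' : θ i₀ ≠ θ' i₀ := by simpa [I] using hi₀
  have ht : ∀ i, θ i ≠ θ' i → 0 < t i ∧ t i < 1 ∧ a i = t i * (a i - c i) := by
    intro i hi
    rcases hI i hi with ⟨h1, h2, _⟩ | ⟨h1, h2, _⟩
    · have h3 : 0 < a i - c i := by linarith
      refine ⟨div_pos h1 h3, ?_, (div_mul_cancel₀ _ h3.ne').symm⟩
      rw [div_lt_one h3]; linarith
    · have h3 : a i - c i < 0 := by linarith
      refine ⟨div_pos_of_neg_of_neg h1 h3, ?_, (div_mul_cancel₀ _ h3.ne).symm⟩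
      rw [div_lt_one_of_neg h3]; linarith
  obtain ⟨ht0, ht1, ht2⟩ := ht i₀ hi₀'
  have hz : ∀ j, eval (x + (- t i₀) • (x - y)) (π j) = a j - t i₀ * (a j - c j) := by
    intro j
    rw [eval_affine _ (hπ j).le]; ring
  refine ⟨x + (- t i₀) • (x - y), i₀, ?_, ?_, ?_⟩
  · rw [hz]; linarith
  · intro j hj
    rw [hz] at hj ⊢
    by_cases h : θ j = θ' j
    · rcases hnI j h with ⟨h1, h2, h3⟩ | ⟨h1, h2, h3⟩
      · rw [h3]; apply sign_pos; nlinarith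
      · rw [h3]; apply sign_neg; nlinarith
    · obtain ⟨_, _, h6⟩ := ht j h
      have h7 : t i₀ ≤ t j := hmin j (by simp [I, h])
      rcases hI j h with ⟨h1, h2, h3⟩ | ⟨h1, h2, h3⟩
      · rw [h3]; apply sign_pos; refine lt_of_le_of_ne ?_ hj.symm; nlinarith
      · rw [h3]; apply sign_neg; refine lt_of_le_of_ne ?_ hj; nlinarith
  · intro j hj
    rw [hz] at hj
    have h : θ j ≠ θ' j := by
      intro h
      rcases hnI j h with ⟨h1, h2, h3⟩ | ⟨h1, h2, h3⟩ <;> nlinarith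
    refine ⟨h, ?_⟩
    change a i₀ * c j = a j * c i₀
    have e1 : (1 - t i₀) * a i₀ = - t i₀ * c i₀ := by linarith
    have e2 : (1 - t i₀) * a j = - t i₀ * c j := by linarith
    have : (1 - t i₀) * (a i₀ * c j - a j * c i₀) = 0 := by linear_combination c j * e1 - c i₀ * e2
    rcases mul_eq_zero.1 this with h8 | h8 <;> linarith

lemma main_induction {n b d : ℕ} (hd : 1 ≤ d)
    (π : Fin b → MvPolynomial (Fin n) ℝ) (hπ : ∀ i, (π i).totalDegree = 1)
    (f : (Fin n → ℝ) → ℝ) (hf : IsSpline π d f)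
    (θ' : Fin b → SignType) (hθ' : ∀ i, θ' i ≠ 0) (y : Fin n → ℝ) (hy : y ∈ piece π θ')
    (h : MvPolynomial (Fin n) ℝ) (hh : ∀ x ∈ piece π θ', f x = eval x h)
    (hhd : h.totalDegree ≤ d) :
    ∀ (m : ℕ) (θ : Fin b → SignType), (∀ i, θ i ≠ 0) → (piece π θ).Nonempty →
      (Finset.univ.filter fun i => θ i ≠ θ' i).card ≤ m →
      ∀ g : MvPolynomial (Fin n) ℝ, g.totalDegree ≤ d → (∀ x ∈ piece π θ, f x = eval x g) →
      g - h ∈ Submodule.span ℝ (π '' {i | θ i ≠ θ' i}) * restrictTotalDegree (Fin n) ℝ (d - 1) := by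
  classical
  intro m
  induction m with
  | zero =>
    intro θ hθ hne hcard g hgd hg
    have heq : θ = θ' := by
      funext i
      by_contra hi
      have := Finset.card_eq_zero.1 (Nat.le_zero.1 hcard)
      have h2 : i ∈ Finset.univ.filter fun i => θ i ≠ θ' i := by simp [hi]
      rw [this] at h2
      simp at h2
    have : g - h = 0 := by
      refine poly_zero_of_open _ _ (isOpen_piece π θ hθ) hne fun x hx => ?_
      rw [map_sub, ← hg x hx, ← hh x (heq ▸ hx), sub_self]
    rw [this]
    exact Submodule.zero_mem _
  | succ m ih =>
    intro θ hθ hne hcard g hgd hg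
    by_cases hall : ∃ i, θ i ≠ θ' i
    swap
    · refine ih θ hθ hne ?_ g hgd hg
      push Not at hall
      simp [hall]
    obtain ⟨x, hx, hgen⟩ := generic_point π y _ (isOpen_piece π θ hθ) hne
    obtain ⟨z, i₀, hz0, hz1, hz2⟩ := crossing π hπ θ θ' hθ hθ' x y hx hy hall
    have hi₀ := (hz2 i₀ hz0).1
    let θ'' : Fin b → SignType := fun j => if eval z (π j) = 0 then θ' j else θ j
    have hθ'' : ∀ j, θ'' j ≠ 0 := by
      intro j; simp only [θ'']; split_ifs
      · exact hθ' j
      · exact hθ j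
    have hy0 : ∀ j, eval y (π j) ≠ 0 := by
      intro j hj
      have := hy j
      rw [hj, sign_zero] at this
      exact hθ' j this.symm
    have hdir : ∀ j, θ j ≠ θ' j → SignType.sign (eval x (π j) - eval y (π j)) = θ j ∧
        SignType.sign (eval y (π j) - eval x (π j)) = θ' j := by
      intro j hj
      have h1 := hx j
      have h2 := hy j
      have h3 := hy0 j
      have h4 : eval x (π j) ≠ 0 := by
        intro h4
        rw [h4, sign_zero] at h1
        exact hθ j h1.symm
      rw [← h1, ← h2] at hj ⊢
      rcases lt_or_gt_of_ne h3 with h3 | h3 <;> rcases lt_or_gt_of_ne h4 with h4 | h4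
      · rw [sign_neg h3, sign_neg h4] at hj; exact absurd rfl hj
      · rw [sign_neg h3, sign_pos h4]
        exact ⟨sign_pos (by linarith), sign_neg (by linarith)⟩
      · rw [sign_pos h3, sign_neg h4]
        exact ⟨sign_neg (by linarith), sign_pos (by linarith)⟩
      · rw [sign_pos h3, sign_pos h4] at hj; exact absurd rfl hj
    let U : Set (Fin n → ℝ) := ⋂ j, {w | eval z (π j) ≠ 0 → 0 < eval w (π j) * eval z (π j)}
    have hU : IsOpen U := by
      refine isOpen_iInter_of_finite fun j => ?_
      by_cases hj : eval z (π j) = 0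
      · simp [hj]
      · simp only [ne_eq, hj, not_false_eq_true, true_imp_iff]
        exact isOpen_lt continuous_const
          ((MvPolynomial.continuous_eval (π j)).mul continuous_const)
    have hzU : z ∈ U := by
      refine Set.mem_iInter.2 fun j hj => ?_
      exact mul_self_pos.2 hj
    have hUs : ∀ w ∈ U, ∀ j, eval z (π j) ≠ 0 →
        eval w (π j) ≠ 0 ∧ SignType.sign (eval w (π j)) = θ j := by
      intro w hw j hj
      have h1 : 0 < eval w (π j) * eval z (π j) := Set.mem_iInter.1 hw j hj
      refine ⟨left_ne_zero_of_mul h1.ne', ?_⟩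
      rw [← hz1 j hj]
      rcases pos_and_pos_or_neg_and_neg_of_mul_pos h1 with ⟨h2, h3⟩ | ⟨h2, h3⟩
      · rw [sign_pos h2, sign_pos h3]
      · rw [sign_neg h2, sign_neg h3]
    have hU0 : ∀ w, eval w (π i₀) = 0 → ∀ j, eval z (π j) = 0 → eval w (π j) = 0 := by
      intro w hw j hj
      have h1 := hgen i₀ j (hz2 j hj).2
      have h2 := congrArg (eval w) h1
      simp only [map_mul, eval_C, hw, mul_zero] at h2
      exact (mul_eq_zero.1 h2.symm).resolve_left (hy0 i₀)
    have hcl : ∀ w ∈ U, eval w (π i₀) = 0 → w ∈ closure (piece π θ) := by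
      intro w hw hw0
      refine mem_closure_piece π hπ θ w x y fun j => ?_
      by_cases hj : eval z (π j) = 0
      · exact Or.inr ⟨hU0 w hw0 j hj, (hdir j (hz2 j hj).1).1⟩
      · exact Or.inl (hUs w hw j hj)
    have hcl'' : ∀ w ∈ U, eval w (π i₀) = 0 → w ∈ closure (piece π θ'') := by
      intro w hw hw0
      refine mem_closure_piece π hπ θ'' w y x fun j => ?_
      by_cases hj : eval z (π j) = 0
      · refine Or.inr ⟨hU0 w hw0 j hj, ?_⟩
        simp only [θ'', if_pos hj]
        exact (hdir j (hz2 j hj).1).2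
      · simp only [θ'', if_neg hj]
        exact Or.inl (hUs w hw j hj)
    have hne'' : (piece π θ'').Nonempty := closure_nonempty_iff.1 ⟨z, hcl'' z hzU hz0⟩
    obtain ⟨g'', hgd'', hg''⟩ := hf.2 θ'' hne''
    have hsub : ∀ j, θ'' j ≠ θ' j → θ j ≠ θ' j := by
      intro j hj
      simp only [θ''] at hj
      split_ifs at hj
      · exact absurd rfl hj
      · exact hj
    have hcard'' : (Finset.univ.filter fun i => θ'' i ≠ θ' i).card ≤ m := by
      have : (Finset.univ.filter fun i => θ'' i ≠ θ' i) ⊂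
          (Finset.univ.filter fun i => θ i ≠ θ' i) := by
        rw [Finset.ssubset_iff_of_subset]
        · exact ⟨i₀, by simp [hi₀], by simp [θ'', hz0]⟩
        · intro j hj
          simp only [Finset.mem_filter, Finset.mem_univ, true_and] at hj ⊢
          exact hsub j hj
      have := Finset.card_lt_card this
      omega
    have key := ih θ'' hθ'' hne'' hcard'' g'' hgd'' hg''
    have key1 : g'' - h ∈ Submodule.span ℝ (π '' {i | θ i ≠ θ' i}) *
        restrictTotalDegree (Fin n) ℝ (d - 1) :=
      mul_le_mul' (Submodule.span_mono (Set.image_mono hsub)) le_rfl key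
    have hdvd : π i₀ ∣ g - g'' := by
      refine dvd_of_vanish _ _ (hπ i₀).le x y ?_ z hz0 U hU hzU ?_
      · intro hxy
        have := (hdir i₀ hi₀).1
        rw [hxy, sub_self, sign_zero] at this
        exact hθ i₀ this.symm
      · intro w hw hw0
        rw [map_sub, ← limit_eq f hf.1 _ g hg w (hcl w hw hw0),
          ← limit_eq f hf.1 _ g'' hg'' w (hcl'' w hw hw0), sub_self]
    obtain ⟨r, hr⟩ := hdvd
    have hrd : r.totalDegree ≤ d - 1 := by
      by_cases hr0 : r = 0
      · simp [hr0]
      · have hp0 : π i₀ ≠ 0 := by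
          intro h0
          have := hπ i₀
          simp [h0] at this
        have h1 := totalDegree_mul_of_isDomain hp0 hr0
        rw [← hr, hπ] at h1
        have h2 := totalDegree_sub g g''
        have h3 := max_le hgd hgd''
        omega
    have : g - h = (g - g'') + (g'' - h) := by ring
    rw [this, hr]
    refine Submodule.add_mem _ (Submodule.mul_mem_mul (Submodule.subset_span ⟨i₀, hi₀, rfl⟩) ?_) key1
    exact (mem_restrictTotalDegree _ _ _).2 hrd

/-- If `g` and `h` are the polynomials a spline `f` of degree `d ≥ 1` restricts
to on two distinct chambers whose closures `V`, `W` intersect, then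
`g − h = π'₁ρ₁ + ⋯ + π'_qρ_q` with `q ≤ n + 1`, where each `π'_k` is a
degree-one polynomial nonnegative on `V` and nonpositive on `W`, and
`deg ρ_k ≤ d − 1`. -/
theorem spline_difference_decomposition {n b d : ℕ} (hd : 1 ≤ d)
    (π : Fin b → MvPolynomial (Fin n) ℝ) (hπ : ∀ i, (π i).totalDegree = 1)
    (f : (Fin n → ℝ) → ℝ) (hf : IsSpline π d f)
    (θ θ' : Fin b → SignType)
    (hcham : (interior (piece π θ)).Nonempty)
    (hcham' : (interior (piece π θ')).Nonempty)
    (hne : piece π θ ≠ piece π θ')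
    (V W : Set (Fin n → ℝ))
    (hV : V = closure (piece π θ)) (hW : W = closure (piece π θ'))
    (hVW : (V ∩ W).Nonempty)
    (g h : MvPolynomial (Fin n) ℝ)
    (hg : ∀ x ∈ piece π θ, f x = eval x g)
    (hh : ∀ x ∈ piece π θ', f x = eval x h) :
    ∃ q : ℕ, q ≤ n + 1 ∧
      ∃ (π' ρ : Fin q → MvPolynomial (Fin n) ℝ),
        (∀ k, (π' k).totalDegree = 1) ∧
        (∀ k, ∀ x ∈ V, 0 ≤ eval x (π' k)) ∧
        (∀ k, ∀ x ∈ W, eval x (π' k) ≤ 0) ∧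
        (∀ k, (ρ k).totalDegree ≤ d - 1) ∧
        g - h = ∑ k, π' k * ρ k := by
  classical
  have hθ := sign_ne_zero_of_interior π hπ θ hcham
  have hθ' := sign_ne_zero_of_interior π hπ θ' hcham'
  have hn := hcham.mono interior_subset
  have hn' := hcham'.mono interior_subset
  have hdeg : ∀ (η : Fin b → SignType), (∀ i, η i ≠ 0) → (piece π η).Nonempty →
      ∀ p : MvPolynomial (Fin n) ℝ, (∀ x ∈ piece π η, f x = eval x p) → p.totalDegree ≤ d := by
    intro η hη hηn p hp
    obtain ⟨p', hp'd, hp'⟩ := hf.2 η hηn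
    have : p - p' = 0 := poly_zero_of_open _ _ (isOpen_piece π η hη) hηn fun x hx => by
      rw [map_sub, ← hp x hx, ← hp' x hx, sub_self]
    rw [sub_eq_zero.1 this]
    exact hp'd
  obtain ⟨y, hy⟩ := hn'
  have key := main_induction hd π hπ f hf θ' hθ' y hy h hh (hdeg θ' hθ' ⟨y, hy⟩ h hh) _ θ hθ hn
    le_rfl g (hdeg θ hθ hn g hg) hg
  let c : Fin b → ℝ := fun i => ((θ i : SignType) : ℝ)
  have hc : ∀ i, (θ i = 1 ∧ c i = 1) ∨ (θ i = -1 ∧ c i = -1) := by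
    intro i
    have := hθ i
    simp only [c]
    cases hi : θ i with
    | zero => exact absurd hi this
    | neg => right; exact ⟨rfl, by simp⟩
    | pos => left; exact ⟨rfl, by simp⟩
  let s : Set (MvPolynomial (Fin n) ℝ) := (fun i => c i • π i) '' {i | θ i ≠ θ' i}
  have hspan : Submodule.span ℝ (π '' {i | θ i ≠ θ' i}) ≤ Submodule.span ℝ s := by
    rw [Submodule.span_le]
    rintro _ ⟨i, hi, rfl⟩
    have h1 : c i • (c i • π i) = π i := by
      rw [smul_smul]
      rcases hc i with ⟨_, h⟩ | ⟨_, h⟩ <;> simp [h]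
    rw [← h1]
    exact Submodule.smul_mem _ _ (Submodule.subset_span ⟨i, hi, rfl⟩)
  have hsdeg : ∀ i, (c i • π i).totalDegree = 1 := by
    intro i
    rcases hc i with ⟨_, h⟩ | ⟨_, h⟩ <;> simp [h, hπ]
  have hfr : Module.finrank ℝ (Submodule.span ℝ s) ≤ n + 1 := by
    have h1 : Submodule.span ℝ s ≤ Submodule.span ℝ (Set.range (fun o : Option (Fin n) =>
        (o.elim 1 X : MvPolynomial (Fin n) ℝ))) := by
      rw [Submodule.span_le]
      rintro _ ⟨i, _, rfl⟩
      exact mem_affine_span _ (hsdeg i).le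
    have : FiniteDimensional ℝ (Submodule.span ℝ (Set.range (fun o : Option (Fin n) =>
        (o.elim 1 X : MvPolynomial (Fin n) ℝ)))) :=
      FiniteDimensional.span_of_finite ℝ (Set.finite_range _)
    refine (Submodule.finrank_mono h1).trans ?_
    refine (finrank_range_le_card _).trans ?_
    simp
  have hfin : Module.Finite ℝ (Submodule.span ℝ s) :=
    FiniteDimensional.span_of_finite ℝ ((Set.toFinite _).image _)
  obtain ⟨F, hF, hFs, -⟩ := Submodule.exists_fun_fin_finrank_span_eq ℝ s
  have key2 : g - h ∈ Submodule.span ℝ (Set.range F) * restrictTotalDegree (Fin n) ℝ (d - 1) := by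
    rw [hFs]
    exact mul_le_mul' hspan le_rfl key
  obtain ⟨ρ, hρ, hsum⟩ := mem_mul_span F _ key2
  refine ⟨_, hfr, F, ρ, ?_, ?_, ?_, hρ, hsum⟩
  · intro k
    obtain ⟨i, _, hi⟩ := hF k
    rw [← hi]; exact hsdeg i
  · intro k
    obtain ⟨i, _, hi⟩ := hF k
    have hcl : IsClosed {x | 0 ≤ eval x (F k)} :=
      isClosed_le continuous_const (MvPolynomial.continuous_eval _)
    rw [hV]
    refine closure_minimal (fun x hx => ?_) hcl
    have h1 := hx i
    change 0 ≤ eval x (F k)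
    rw [← hi, smul_eval]
    rcases hc i with ⟨h2, h3⟩ | ⟨h2, h3⟩
    · rw [h2, sign_eq_one_iff] at h1; rw [h3]; linarith
    · rw [h2, sign_eq_neg_one_iff] at h1; rw [h3]; linarith
  · intro k
    obtain ⟨i, hi', hi⟩ := hF k
    have hcl : IsClosed {x | eval x (F k) ≤ 0} :=
      isClosed_le (MvPolynomial.continuous_eval _) continuous_const
    rw [hW]
    refine closure_minimal (fun x hx => ?_) hcl
    have h1 := hx i
    change eval x (F k) ≤ 0
    rw [← hi, smul_eval]
    have h4 := hθ' i
    have hi'' : θ i ≠ θ' i := hi'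
    rcases hc i with ⟨h2, h3⟩ | ⟨h2, h3⟩
    · have h5 : θ' i = -1 := by
        revert hi'' h4; rw [h2]; generalize θ' i = u; revert u; decide
      rw [h5, sign_eq_neg_one_iff] at h1; rw [h3]; linarith
    · have h5 : θ' i = 1 := by
        revert hi'' h4; rw [h2]; generalize θ' i = u; revert u; decide
      rw [h5, sign_eq_one_iff] at h1; rw [h3]; linarith
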